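/- arXiv:1809.02317 — 2 statements merged into one kernel-verified Lean document; each statement's English description precedes it below -/
import Mathlib

section
/- Let ι be a finite index type, m a natural number, and F : (ι → (Fin m → ℝ)) → (Fin m → ℝ) a function that is monotone with respect to the componentwise (pointwise-in-ι and pointwise-in-components) orders. For each i ∈ ι let A i be a finite set of QoS tuples. Then the set of non-dominated elements of { F c : ∀ i, c i ∈ A i } equals the set of non-dominated elements of { F c : ∀ i, c i ∈ Pareto(A i) }, where Pareto(A i) denotes the set of non-dominated elements of A i. -/
/-- `t'` dominates `t` (componentwise order on `Fin m → ℝ`). -/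
def Dominates {m : ℕ} (t' t : Fin m → ℝ) : Prop := t ≤ t' ∧ t ≠ t'

/-- `t` is non-dominated (Pareto optimal) in `S`. -/
def NonDominated {m : ℕ} (S : Set (Fin m → ℝ)) (t : Fin m → ℝ) : Prop :=
  t ∈ S ∧ ∀ t' ∈ S, ¬ Dominates t' t

/-- The Pareto front (set of non-dominated elements) of `S`. -/
def Pareto {m : ℕ} (S : Set (Fin m → ℝ)) : Set (Fin m → ℝ) :=
  {t | NonDominated S t}

theorem pareto_eq_setOf_maximal {m : ℕ} (S : Set (Fin m → ℝ)) :
    Pareto S = {t | Maximal (· ∈ S) t} := by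
  ext t
  refine ⟨fun ⟨ht, hmax⟩ => ⟨ht, fun t' ht' hle => ?_⟩,
    fun ht => ⟨ht.prop, fun t' ht' hdom => hdom.2 (ht.eq_of_le ht' hdom.1)⟩⟩
  by_contra hnot
  exact hmax t' ht' ⟨hle, fun heq => hnot heq.ge⟩

/-- A subset that dominates every element of `S` weakly has the same Pareto front as `S`. -/
theorem pareto_eq_of_subset_of_forall_exists_le {m : ℕ} {S T : Set (Fin m → ℝ)}
    (hTS : T ⊆ S) (hST : ∀ s ∈ S, ∃ t ∈ T, s ≤ t) : Pareto S = Pareto T := by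
  simp only [pareto_eq_setOf_maximal]
  ext x
  constructor
  · intro hx
    obtain ⟨t, ht, hxt⟩ := hST x hx.prop
    obtain rfl := hx.eq_of_le (hTS ht) hxt
    exact ⟨ht, fun y hy hle => hx.le_of_ge (hTS hy) hle⟩
  · intro hx
    refine ⟨hTS hx.prop, fun y hy hle => ?_⟩
    obtain ⟨t, ht, hyt⟩ := hST y hy
    exact hyt.trans (hx.le_of_ge ht (hle.trans hyt))

theorem exists_le_mem_pareto {m : ℕ} (A : Finset (Fin m → ℝ)) {a : Fin m → ℝ} (ha : a ∈ A) :
    ∃ b ∈ Pareto (A : Set (Fin m → ℝ)), a ≤ b := by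
  obtain ⟨b, hab, hb⟩ := A.exists_le_maximal ha
  exact ⟨b, by simpa [pareto_eq_setOf_maximal] using hb, hab⟩

theorem stmt_5 {ι : Type*} [Fintype ι] {m : ℕ}
    (F : (ι → (Fin m → ℝ)) → (Fin m → ℝ)) (hF : Monotone F)
    (A : ι → Finset (Fin m → ℝ)) :
    Pareto (F '' {c | ∀ i, c i ∈ A i}) =
      Pareto (F '' {c | ∀ i, c i ∈ Pareto ↑(A i)}) := by
  refine pareto_eq_of_subset_of_forall_exists_le
    (Set.image_mono fun c hc i => (hc i).1) ?_
  rintro _ ⟨c, hc, rfl⟩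
  choose d hd hcd using fun i => exists_le_mem_pareto (A i) (hc i)
  exact ⟨F d, ⟨d, hd, rfl⟩, hF hcd⟩
end

section
/- Let ι be a finite index type, m a natural number, F : (ι → (Fin m → ℝ)) → (Fin m → ℝ) a function monotone with respect to the componentwise orders, and Feas ⊆ ℝ^m an upper set for the componentwise order. For each i ∈ ι let A i be a finite set of QoS tuples. Then the set of non-dominated elements of { F c : ∀ i, c i ∈ A i } ∩ Feas equals the set of non-dominated elements of { F c : ∀ i, c i ∈ Pareto(A i) } ∩ Feas, where Pareto(A i) is the set of non-dominated elements of A i. -/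
theorem pareto_subset {m : ℕ} (S : Set (Fin m → ℝ)) : Pareto S ⊆ S :=
  fun _ ht => ht.1

theorem exists_pareto_ge {m : ℕ} {S : Set (Fin m → ℝ)} (hS : S.Finite)
    {t : Fin m → ℝ} (ht : t ∈ S) : ∃ t' ∈ Pareto S, t ≤ t' := by
  obtain ⟨t', hle, hmax⟩ := hS.exists_le_maximal ht
  exact ⟨t', ⟨hmax.prop, fun _ hu h => h.2 (hmax.eq_of_le hu h.1)⟩, hle⟩

/-- A subset that is cofinal for the componentwise order has the same Pareto front. -/
theorem pareto_eq_of_subset_of_cofinal {m : ℕ} {S T : Set (Fin m → ℝ)} (hTS : T ⊆ S)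
    (hcof : ∀ s ∈ S, ∃ t ∈ T, s ≤ t) : Pareto S = Pareto T := by
  ext x
  constructor
  · rintro ⟨hx, hmax⟩
    obtain ⟨t, ht, hle⟩ := hcof x hx
    obtain rfl : x = t := by_contra fun hne => hmax t (hTS ht) ⟨hle, hne⟩
    exact ⟨ht, fun u hu => hmax u (hTS hu)⟩
  · rintro ⟨hx, hmax⟩
    refine ⟨hTS hx, fun s hs hdom => ?_⟩
    obtain ⟨t, ht, hle⟩ := hcof s hs
    refine hmax t ht ⟨hdom.1.trans hle, ?_⟩
    rintro rfl
    exact hdom.2 (le_antisymm hdom.1 hle)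

theorem stmt_12 {ι : Type*} [Fintype ι] {m : ℕ}
    (F : (ι → (Fin m → ℝ)) → (Fin m → ℝ)) (hF : Monotone F)
    (Feas : Set (Fin m → ℝ)) (hFeas : IsUpperSet Feas)
    (A : ι → Finset (Fin m → ℝ)) :
    Pareto ((F '' {c | ∀ i, c i ∈ A i}) ∩ Feas) =
      Pareto ((F '' {c | ∀ i, c i ∈ Pareto ↑(A i)}) ∩ Feas) := by
  apply pareto_eq_of_subset_of_cofinal
  · rintro _ ⟨⟨c, hc, rfl⟩, hfeas⟩
    exact ⟨⟨c, fun i => pareto_subset _ (hc i), rfl⟩, hfeas⟩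
  · rintro _ ⟨⟨c, hc, rfl⟩, hfeas⟩
    choose d hd hle using fun i => exists_pareto_ge (A i).finite_toSet (hc i)
    exact ⟨F d, ⟨⟨d, hd, rfl⟩, hFeas (hF hle) hfeas⟩, hF hle⟩
end
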